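/- arXiv:2306.02364 — 3 statements merged into one kernel-verified Lean document; each statement's English description precedes it below -/
import Mathlib

section
/- For every integer c ≥ 1 there exists an integer d ≥ 1 such that every tournament G with dom(G) ≥ d has a complete pair (A,B) with χ(A) ≥ c, χ(B) ≥ c, and dom(G[A]) ≥ c. -/
structure Tournament where
  V : Type
  fintype : Fintype V
  adj : V → V → Prop
  asymm : ∀ u v, adj u v → ¬ adj v u
  total : ∀ u v, u ≠ v → adj u v ∨ adj v u

attribute [instance] Tournament.fintype

namespace Tournament

/-- A set of vertices is transitive if it includes no cyclic triangle. -/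
def IsTransitiveSet (T : Tournament) (A : Set T.V) : Prop :=
  ∀ a ∈ A, ∀ b ∈ A, ∀ c ∈ A, T.adj a b → T.adj b c → ¬ T.adj c a

/-- The chromatic number of the subtournament induced on `A`. -/
noncomputable def chiOn (T : Tournament) (A : Set T.V) : ℕ :=
  sInf {k | ∃ C : Fin k → Set T.V, (∀ i, T.IsTransitiveSet (C i)) ∧ A ⊆ ⋃ i, C i}

noncomputable def chi (T : Tournament) : ℕ := T.chiOn Set.univ

def outN (T : Tournament) (v : T.V) : Set T.V := {u | T.adj v u}
def inN (T : Tournament) (v : T.V) : Set T.V := {u | T.adj u v}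

/-- The domination number of the subtournament induced on `A`. -/
noncomputable def domOn (T : Tournament) (A : Set T.V) : ℕ :=
  sInf {n | ∃ X : Finset T.V, ↑X ⊆ A ∧ (∀ v ∈ A, v ∉ X → ∃ x ∈ X, T.adj x v) ∧ X.card = n}

noncomputable def dom (T : Tournament) : ℕ := T.domOn Set.univ

/-- `A ⇒ B`: every edge between `A` and `B` is directed from `A` to `B`. -/
def CompleteTo (T : Tournament) (A B : Set T.V) : Prop :=
  ∀ a ∈ A, ∀ b ∈ B, T.adj a b

def CompletePair (T : Tournament) (A B : Set T.V) : Prop :=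
  Disjoint A B ∧ T.CompleteTo A B

/-- `G` has a subtournament inside `A` isomorphic to `H`. -/
def ContainsOn (G : Tournament) (A : Set G.V) (H : Tournament) : Prop :=
  ∃ f : H.V → G.V, Function.Injective f ∧ (∀ u, f u ∈ A) ∧
    ∀ u v, H.adj u v ↔ G.adj (f u) (f v)

def Contains (G H : Tournament) : Prop := G.ContainsOn Set.univ H

def IsHero (H : Tournament) : Prop :=
  ∃ c > 0, ∀ G : Tournament, ¬ G.Contains H → G.chi < c

def IsRebel (H : Tournament) : Prop :=
  ∃ c > 0, ∀ G : Tournament, ¬ G.Contains H → G.dom < c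

end Tournament

namespace Tournament

/-- `A` can be covered by `k` transitive sets. -/
def Col (T : Tournament) (k : ℕ) (A : Set T.V) : Prop :=
  ∃ C : Fin k → Set T.V, (∀ i, T.IsTransitiveSet (C i)) ∧ A ⊆ ⋃ i, C i

lemma Col.mono {T : Tournament} {k n : ℕ} {A B : Set T.V} (h : T.Col k B) (hk : k ≤ n)
    (hAB : A ⊆ B) : T.Col n A := by
  obtain ⟨C, hC, hB⟩ := h
  refine ⟨fun i => if hi : i.1 < k then C ⟨i.1, hi⟩ else ∅, ?_, ?_⟩
  · intro i
    by_cases hi : i.1 < k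
    · simpa [hi] using hC ⟨i.1, hi⟩
    · simp [hi, IsTransitiveSet]
  · intro a ha
    obtain ⟨i, hi⟩ := Set.mem_iUnion.1 (hB (hAB ha))
    exact Set.mem_iUnion.2 ⟨⟨i.1, lt_of_lt_of_le i.2 hk⟩, by simpa using hi⟩

lemma exists_col (T : Tournament) (A : Set T.V) : ∃ k, T.Col k A := by
  refine ⟨Fintype.card T.V, fun i => {(Fintype.equivFin T.V).symm i}, ?_, ?_⟩
  · intro i a ha b hb c hc hab
    rw [Set.mem_singleton_iff] at ha hb
    subst ha; subst hb
    exact absurd hab (T.asymm _ _ hab)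
  · intro a _
    exact Set.mem_iUnion.2 ⟨Fintype.equivFin T.V a, by simp⟩

lemma le_chiOn {T : Tournament} {k : ℕ} {A : Set T.V} (h : ¬ T.Col k A) : k ≤ T.chiOn A := by
  by_contra hlt
  push Not at hlt
  have hm : T.Col (T.chiOn A) A :=
    Nat.sInf_mem (s := {k | ∃ C : Fin k → Set T.V, (∀ i, T.IsTransitiveSet (C i)) ∧ A ⊆ ⋃ i, C i})
      (T.exists_col A)
  exact h (hm.mono hlt.le le_rfl)

/-- Every colour class meets a set that needs more colours. -/
lemma color_used {T : Tournament} {k : ℕ} {A : Set T.V} (h : ¬ T.Col k A)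
    (C : Fin (k + 1) → Set T.V) (hC : ∀ i, T.IsTransitiveSet (C i)) (hA : A ⊆ ⋃ i, C i)
    (i : Fin (k + 1)) : ∃ a ∈ A, a ∈ C i := by
  by_contra hne
  push Not at hne
  refine h ⟨fun j => C (i.succAbove j), fun j => hC _, ?_⟩
  intro a ha
  obtain ⟨j, hj⟩ := Set.mem_iUnion.1 (hA ha)
  have hji : j ≠ i := by
    rintro rfl
    exact hne a ha hj
  obtain ⟨j', rfl⟩ := Fin.exists_succAbove_eq hji
  exact Set.mem_iUnion.2 ⟨j', hj⟩

lemma domOn_le {T : Tournament} {P : Set T.V} (X : Finset T.V) (hX : ↑X ⊆ P)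
    (h : ∀ v ∈ P, v ∉ X → ∃ x ∈ X, T.adj x v) : T.domOn P ≤ X.card :=
  Nat.sInf_le ⟨X, hX, h, rfl⟩

lemma exists_domOn (T : Tournament) (P : Set T.V) :
    ∃ X : Finset T.V, ↑X ⊆ P ∧ (∀ v ∈ P, v ∉ X → ∃ x ∈ X, T.adj x v) ∧ X.card = T.domOn P := by
  classical
  refine Nat.sInf_mem (s := {n | ∃ X : Finset T.V, ↑X ⊆ P ∧
    (∀ v ∈ P, v ∉ X → ∃ x ∈ X, T.adj x v) ∧ X.card = n}) ?_
  refine ⟨_, Finset.univ.filter (· ∈ P), ?_, ?_, rfl⟩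
  · intro x hx
    simpa using hx
  · intro v hv hn
    simp [hv] at hn

/-- Vertices of `P` complete to `B`. -/
def undom (T : Tournament) (P : Set T.V) (B : Finset T.V) : Set T.V :=
  {v | v ∈ P ∧ v ∉ B ∧ ∀ b ∈ B, ¬ T.adj b v}

lemma undom_adj {T : Tournament} {P : Set T.V} {B : Finset T.V} {v b : T.V}
    (hv : v ∈ T.undom P B) (hb : b ∈ B) : T.adj v b := by
  rcases T.total v b (fun h => hv.2.1 (h ▸ hb)) with h | h
  · exact h
  · exact absurd h (hv.2.2 b hb)

lemma domOn_undom {T : Tournament} {P : Set T.V} {B : Finset T.V} (hB : ↑B ⊆ P) :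
    T.domOn P ≤ T.domOn (T.undom P B) + B.card := by
  classical
  obtain ⟨X, hX, hd, hc⟩ := T.exists_domOn (T.undom P B)
  rw [← hc]
  refine (domOn_le (X ∪ B) ?_ ?_).trans (Finset.card_union_le _ _)
  · rw [Finset.coe_union]
    exact Set.union_subset (hX.trans fun v hv => hv.1) hB
  · intro v hv hn
    rw [Finset.mem_union, not_or] at hn
    by_cases h : ∃ b ∈ B, T.adj b v
    · obtain ⟨b, hb, hbv⟩ := h
      exact ⟨b, Finset.mem_union_right _ hb, hbv⟩
    · push Not at h
      obtain ⟨x, hx, hxv⟩ := hd v ⟨hv, hn.2, h⟩ hn.1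
      exact ⟨x, Finset.mem_union_left _ hx, hxv⟩

/-- Large domination number yields a bounded-size subtournament of large chromatic number. -/
lemma small_chi (k : ℕ) : ∃ K l : ℕ, ∀ (T : Tournament) (P : Set T.V), K ≤ T.domOn P →
    ∃ A : Finset T.V, ↑A ⊆ P ∧ A.card ≤ l ∧ ¬ T.Col k ↑A := by
  classical
  induction k with
  | zero =>
    refine ⟨1, 1, fun T P hP => ?_⟩
    have hne : P.Nonempty := by
      by_contra hemp
      rw [Set.not_nonempty_iff_eq_empty] at hemp
      subst hemp
      have := domOn_le (T := T) (P := ∅) ∅ (by simp) (by simp)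
      simp at this
      omega
    obtain ⟨p, hp⟩ := hne
    refine ⟨{p}, by simpa using hp, by simp, ?_⟩
    rintro ⟨C, -, hC⟩
    obtain ⟨i, -⟩ := Set.mem_iUnion.1 (hC (a := p) (by simp))
    exact i.elim0
  | succ k ih =>
    obtain ⟨K, l, ih⟩ := ih
    set m := K + l + 1 with hm
    set w := (k + 1) * (K + l) + 1 with hw
    refine ⟨w + K, l + w + 2 ^ w * l, fun T P hP => ?_⟩
    obtain ⟨D, hDP, hD, hDc⟩ := T.exists_domOn P
    obtain ⟨W, hWD, hWc⟩ := Finset.exists_subset_card_eq (s := D) (n := w) (by omega)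
    have hWP : (↑W : Set T.V) ⊆ P := fun v hv => hDP (hWD hv)
    have h1 := domOn_undom (T := T) hWP
    obtain ⟨A, hAU, hAl, hAc⟩ := ih T (T.undom P W) (by omega)
    have hAne : A.Nonempty := by
      by_contra hemp
      rw [Finset.not_nonempty_iff_eq_empty] at hemp
      subst hemp
      exact hAc ⟨fun _ => ∅, fun i => by simp [IsTransitiveSet], by simp⟩
    have hS : ∀ S : Finset T.V, ∃ F : Finset T.V, F.card ≤ l ∧ ↑F ⊆ P ∧
        (S ⊆ W → S.card = m → ¬ T.Col k ↑F ∧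
          ∀ v ∈ F, (∃ s ∈ S, T.adj s v) ∧ ∀ a ∈ A, T.adj v a) := by
      intro S
      by_cases hSW : S ⊆ W ∧ S.card = m
      swap
      · exact ⟨∅, by simp, by simp, fun h h' => absurd ⟨h, h'⟩ hSW⟩
      obtain ⟨hSW, hSm⟩ := hSW
      set Q : Set T.V := {v | v ∈ T.undom P A ∧ ∃ s ∈ S, T.adj s v} with hQ
      have hQK : K ≤ T.domOn Q := by
        by_contra hlt
        push Not at hlt
        obtain ⟨X, hXQ, hXd, hXc⟩ := T.exists_domOn Q
        have hle : T.domOn P ≤ ((D \ S) ∪ (A ∪ X)).card := by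
          refine domOn_le _ ?_ ?_
          · intro v hv
            simp only [Finset.coe_union, Set.mem_union, Finset.mem_coe, Finset.mem_sdiff] at hv
            rcases hv with hv | hv | hv
            · exact hDP hv.1
            · exact (hAU hv).1
            · exact (hXQ hv).1.1
          · intro v hv hn
            simp only [Finset.mem_union, Finset.mem_sdiff, not_or] at hn
            obtain ⟨hn1, hn2, hn3⟩ := hn
            by_cases hvS : v ∈ S
            · obtain ⟨a, ha⟩ := hAne
              exact ⟨a, by simp [ha], undom_adj (hAU ha) (hSW hvS)⟩
            · obtain ⟨d, hd, hdv⟩ := hD v hv (fun h => hn1 ⟨h, hvS⟩)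
              by_cases hdS : d ∈ S
              · by_cases hA : ∃ a ∈ A, T.adj a v
                · obtain ⟨a, ha, hav⟩ := hA
                  exact ⟨a, by simp [ha], hav⟩
                · push Not at hA
                  obtain ⟨x, hx, hxv⟩ := hXd v ⟨⟨hv, hn2, hA⟩, d, hdS, hdv⟩ hn3
                  exact ⟨x, by simp [hx], hxv⟩
              · exact ⟨d, by simp [hd, hdS], hdv⟩
        have h2 := Finset.card_union_le (D \ S) (A ∪ X)
        have h3 := Finset.card_union_le A X
        have h4 := Finset.card_sdiff_add_card_eq_card (hSW.trans hWD)
        omega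
      obtain ⟨F, hFQ, hFl, hFc⟩ := ih T Q hQK
      refine ⟨F, hFl, fun v hv => (hFQ hv).1.1, fun _ _ => ⟨hFc, fun v hv => ⟨(hFQ hv).2, ?_⟩⟩⟩
      intro a ha
      exact undom_adj (hFQ hv).1 ha
    choose F hFl hFP hF using hS
    refine ⟨A ∪ W ∪ W.powerset.biUnion F, ?_, ?_, ?_⟩
    · intro v hv
      simp only [Finset.coe_union, Set.mem_union, Finset.mem_coe, Finset.mem_biUnion] at hv
      rcases hv with (hv | hv) | ⟨S, -, hv⟩
      · exact (hAU hv).1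
      · exact hWP hv
      · exact hFP S hv
    · have h2 := Finset.card_union_le (A ∪ W) (W.powerset.biUnion F)
      have h3 := Finset.card_union_le A W
      have h4 := Finset.card_biUnion_le_card_mul W.powerset F l (fun S _ => hFl S)
      rw [Finset.card_powerset, hWc] at h4
      omega
    · rintro ⟨C, hC, hcov⟩
      have hcW : ∀ v : T.V, ∃ i, v ∈ W → v ∈ C i := by
        intro v
        by_cases hv : v ∈ W
        · obtain ⟨i, hi⟩ := Set.mem_iUnion.1 (hcov (a := v) (by simp [hv]))
          exact ⟨i, fun _ => hi⟩
        · exact ⟨0, fun h => absurd h hv⟩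
      choose f hf using hcW
      obtain ⟨i, -, hi⟩ := Finset.exists_lt_card_fiber_of_mul_lt_card_of_maps_to
        (s := W) (t := Finset.univ) (f := f) (n := K + l) (fun _ _ => Finset.mem_univ _)
        (by simp only [Finset.card_univ, Fintype.card_fin]; omega)
      obtain ⟨S, hSs, hSm⟩ := Finset.exists_subset_card_eq (n := m) (Nat.succ_le_of_lt hi)
      have hSW : S ⊆ W := hSs.trans (Finset.filter_subset _ _)
      obtain ⟨hFc, hFadj⟩ := hF S hSW hSm
      obtain ⟨a, ha, hai⟩ := color_used hAc C hC (fun v hv => hcov (by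
        simp only [Finset.coe_union]; exact Or.inl (Or.inl hv))) i
      obtain ⟨b, hb, hbi⟩ := color_used hFc C hC (fun v hv => hcov (by
        simp only [Finset.coe_union]
        exact Or.inr (Finset.mem_coe.2 (Finset.mem_biUnion.2
          ⟨S, Finset.mem_powerset.2 hSW, hv⟩)))) i
      obtain ⟨⟨s, hs, hsb⟩, hba⟩ := hFadj b hb
      have hsi : s ∈ C i := by
        have h5 := Finset.mem_filter.1 (hSs hs)
        have h6 := hf s h5.1
        rwa [h5.2] at h6
      exact hC i s hsi b hbi a hai hsb (hba a ha) (undom_adj (hAU ha) (hSW hs))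

end Tournament

/-- For every `c ≥ 1` there is `d ≥ 1` such that every tournament with domination
number at least `d` has a complete pair `(A,B)` with `χ(A), χ(B) ≥ c` and
`dom(G[A]) ≥ c`. -/
theorem bigdom (c : ℕ) (hc : 1 ≤ c) :
    ∃ d : ℕ, 1 ≤ d ∧ ∀ G : Tournament, d ≤ G.dom →
      ∃ A B : Set G.V, G.CompletePair A B ∧
        c ≤ G.chiOn A ∧ c ≤ G.chiOn B ∧ c ≤ G.domOn A := by
  obtain ⟨K, l, h⟩ := Tournament.small_chi c
  refine ⟨K + l + c, by omega, fun G hG => ?_⟩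
  have hG' : K + l + c ≤ G.domOn Set.univ := hG
  obtain ⟨B, -, hBl, hBc⟩ := h G Set.univ (by omega)
  have h1 := Tournament.domOn_undom (T := G) (P := Set.univ) (B := B) (Set.subset_univ _)
  obtain ⟨A, hAU, -, hAc⟩ := h G (G.undom Set.univ B) (by omega)
  refine ⟨G.undom Set.univ B, ↑B, ⟨?_, ?_⟩, ?_, Tournament.le_chiOn hBc, by omega⟩
  · exact Set.disjoint_left.2 fun v hv hB => hv.2.1 hB
  · exact fun a ha b hb => Tournament.undom_adj ha hb
  · exact Tournament.le_chiOn fun hcol => hAc (hcol.mono le_rfl hAU)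
end

section
/- For every integer c ≥ 0 there exist integers K and k such that every tournament G with dom(G) ≥ K contains three pairwise disjoint sets A, B, C ⊆ V(G) with |A|, |B|, |C| ≤ k, with χ(A), χ(B), χ(C) ≥ c, and with A ⇒ B, B ⇒ C and C ⇒ A. -/
open scoped Classical

namespace BigTri

variable (G : Tournament)

theorem chi_attained (A : Set G.V) :
    ∃ C : Fin (G.chiOn A) → Set G.V, (∀ i, G.IsTransitiveSet (C i)) ∧ A ⊆ ⋃ i, C i := by
  have hne : {k | ∃ C : Fin k → Set G.V, (∀ i, G.IsTransitiveSet (C i)) ∧ A ⊆ ⋃ i, C i}.Nonempty := by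
    refine ⟨Fintype.card G.V, fun i => {(Fintype.equivFin G.V).symm i}, ?_, ?_⟩
    · intro i a ha b hb c hc hab hbc hca
      simp only [Set.mem_singleton_iff] at ha hb hc
      subst ha hb
      exact G.asymm _ _ hab hab
    · intro a _
      simp only [Set.mem_iUnion, Set.mem_singleton_iff]
      exact ⟨Fintype.equivFin G.V a, by simp⟩
  exact Nat.sInf_mem hne

theorem chi_le_of {n : ℕ} {A : Set G.V} (C : Fin n → Set G.V)
    (h1 : ∀ i, G.IsTransitiveSet (C i)) (h2 : A ⊆ ⋃ i, C i) : G.chiOn A ≤ n :=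
  Nat.sInf_le ⟨C, h1, h2⟩

theorem chi_mono {A B : Set G.V} (h : A ⊆ B) : G.chiOn A ≤ G.chiOn B := by
  obtain ⟨C, h1, h2⟩ := chi_attained G B
  exact chi_le_of G C h1 (h.trans h2)

theorem chi_union (A B : Set G.V) : G.chiOn (A ∪ B) ≤ G.chiOn A + G.chiOn B := by
  obtain ⟨C, h1, h2⟩ := chi_attained G A
  obtain ⟨C', h1', h2'⟩ := chi_attained G B
  refine chi_le_of G (Fin.append C C') ?_ ?_
  · intro i
    refine Fin.addCases (fun i => ?_) (fun i => ?_) i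
    · simpa using h1 i
    · simpa using h1' i
  · rintro a (ha | ha)
    · obtain ⟨i, hi⟩ := Set.mem_iUnion.1 (h2 ha)
      exact Set.mem_iUnion.2 ⟨Fin.castAdd _ i, by simpa using hi⟩
    · obtain ⟨i, hi⟩ := Set.mem_iUnion.1 (h2' ha)
      exact Set.mem_iUnion.2 ⟨Fin.natAdd _ i, by simpa using hi⟩

theorem chi_empty : G.chiOn ∅ = 0 := by
  have := chi_le_of G (n := 0) (A := ∅) (fun _ => ∅) (fun i => i.elim0) (by simp)
  omega

theorem chi_singleton (a : G.V) : G.chiOn {a} ≤ 1 := by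
  refine chi_le_of G (n := 1) (fun _ => {a}) ?_ ?_
  · intro i x hx y hy z hz hxy _ _
    simp only [Set.mem_singleton_iff] at hx hy
    subst hx hy
    exact G.asymm _ _ hxy hxy
  · intro x hx
    exact Set.mem_iUnion.2 ⟨0, hx⟩

theorem chi_biUnion {ι : Type*} (s : Finset ι) (B : ι → Set G.V) :
    G.chiOn (⋃ i ∈ s, B i) ≤ ∑ i ∈ s, G.chiOn (B i) := by
  induction s using Finset.induction_on with
  | empty => simp [chi_empty]
  | insert a s ha ih =>
    rw [Finset.set_biUnion_insert, Finset.sum_insert ha]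
    exact (chi_union G _ _).trans (by omega)

theorem chi_le_card (A : Finset G.V) : G.chiOn (A : Set G.V) ≤ A.card := by
  have h := chi_biUnion G A (fun a => {a})
  have h2 : (A : Set G.V) ⊆ ⋃ i ∈ A, {i} := by
    intro a ha
    simpa using ha
  calc _ ≤ _ := chi_mono G h2
    _ ≤ _ := h
    _ ≤ ∑ i ∈ A, 1 := Finset.sum_le_sum (fun i _ => chi_singleton G i)
    _ = _ := by simp

theorem chi_nonempty {A : Finset G.V} (h : 1 ≤ G.chiOn (A : Set G.V)) : A.Nonempty := by
  rw [Finset.nonempty_iff_ne_empty]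
  rintro rfl
  simp [chi_empty] at h

theorem chi_sdiff (X Y : Finset G.V) :
    G.chiOn (X : Set G.V) ≤ G.chiOn (↑(X ∩ Y) : Set G.V) + G.chiOn (↑(X \ Y) : Set G.V) := by
  refine le_trans (chi_mono G ?_) (chi_union G _ _)
  intro x hx
  by_cases h : x ∈ Y <;> simp_all

theorem chi_filter (X : Finset G.V) (p : G.V → Prop) [DecidablePred p] :
    G.chiOn (X : Set G.V) ≤ G.chiOn (↑(X.filter p) : Set G.V)
      + G.chiOn (↑(X.filter (fun x => ¬ p x)) : Set G.V) := by
  refine le_trans (chi_mono G ?_) (chi_union G _ _)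
  intro x hx
  by_cases h : p x <;> simp_all

/-- complete pairs, for finsets -/
def To (A B : Finset G.V) : Prop := ∀ a ∈ A, ∀ b ∈ B, G.adj a b

theorem irrefl (a : G.V) : ¬ G.adj a a := fun h => G.asymm _ _ h h

theorem To.disj {G : Tournament} {A B : Finset G.V} (h : To G A B) : Disjoint A B := by
  rw [Finset.disjoint_left]
  intro a ha hb
  exact irrefl G a (h a ha a hb)

theorem To.mono {G : Tournament} {A B A' B' : Finset G.V} (h : To G A B) (h1 : A' ⊆ A)
    (h2 : B' ⊆ B) : To G A' B' := fun a ha b hb => h a (h1 ha) b (h2 hb)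

theorem trace_lemma (c k : ℕ) (hc : 1 ≤ c) (X Y : Finset G.V) (hY : Y.card ≤ k)
    (hX : c * 2 ^ k + k ≤ G.chiOn (X : Set G.V)) :
    ∃ X₂ ⊆ X, ∃ Q ⊆ Y, c ≤ G.chiOn (X₂ : Set G.V) ∧ To G Q X₂ ∧ To G X₂ (Y \ Q) := by
  by_contra hcon
  push Not at hcon
  let F : Finset G.V → Finset G.V := fun Q => (X \ Y).filter (fun x => Y.filter (fun y => G.adj y x) = Q)
  have hF : ∀ Q ∈ Y.powerset, G.chiOn (F Q : Set G.V) ≤ c - 1 := by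
    intro Q hQ
    by_contra hlt
    refine hcon (F Q) ?_ Q (Finset.mem_powerset.1 hQ) (by omega) ?_ ?_
    · intro x hx
      simp only [F, Finset.mem_filter, Finset.mem_sdiff] at hx
      exact hx.1.1
    · intro q hq x hx
      simp only [F, Finset.mem_filter, Finset.mem_sdiff] at hx
      rw [← hx.2] at hq
      exact (Finset.mem_filter.1 hq).2
    · intro x hx y hy
      simp only [F, Finset.mem_filter, Finset.mem_sdiff] at hx hy
      have hne : x ≠ y := by
        rintro rfl
        exact hx.1.2 hy.1
      rcases G.total x y hne with h | h
      · exact h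
      · exact absurd (by rw [← hx.2]; exact Finset.mem_filter.2 ⟨hy.1, h⟩) hy.2
  have h1 := chi_sdiff G X Y
  have h2 : G.chiOn (↑(X ∩ Y) : Set G.V) ≤ k :=
    (chi_le_card G _).trans ((Finset.card_le_card Finset.inter_subset_right).trans hY)
  have h3 : G.chiOn (↑(X \ Y) : Set G.V) ≤ ∑ Q ∈ Y.powerset, G.chiOn (F Q : Set G.V) := by
    refine le_trans (chi_mono G ?_) (chi_biUnion G _ _)
    intro x hx
    simp only [Set.mem_iUnion]
    exact ⟨Y.filter (fun y => G.adj y x), Finset.mem_powerset.2 (Finset.filter_subset _ _),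
      Finset.mem_coe.2 (Finset.mem_filter.2 ⟨Finset.mem_coe.1 hx, rfl⟩)⟩
  have h4 : ∑ Q ∈ Y.powerset, G.chiOn (F Q : Set G.V) ≤ 2 ^ Y.card * (c - 1) := by
    refine (Finset.sum_le_sum hF).trans ?_
    simp
  have h5 : 2 ^ Y.card * (c - 1) ≤ 2 ^ k * (c - 1) :=
    Nat.mul_le_mul_right _ (Nat.pow_le_pow_right (by norm_num) hY)
  obtain ⟨d, rfl⟩ : ∃ d, c = d + 1 := ⟨c - 1, by omega⟩
  have h6 : 0 < 2 ^ k := by positivity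
  simp only [Nat.add_sub_cancel] at *
  nlinarith

/-- domination predicate -/
def Dm (S : Finset G.V) (K : ℕ) : Prop :=
  ∀ X ⊆ S, X.card < K → ∃ v ∈ S, ∀ x ∈ X, G.adj v x

theorem Dm_of_dom {K : ℕ} (h : K ≤ G.dom) : Dm G Finset.univ K := by
  intro X _ hX
  by_contra hcon
  push Not at hcon
  have : G.dom ≤ X.card := by
    refine Nat.sInf_le ⟨X, Set.subset_univ _, ?_, rfl⟩
    intro v _ hv
    obtain ⟨x, hx, hvx⟩ := hcon v (Finset.mem_univ _)
    refine ⟨x, hx, (G.total x v ?_).resolve_right hvx⟩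
    rintro rfl
    exact hv hx
  omega

theorem Dm.restrict {G : Tournament} {S U : Finset G.V} {K m : ℕ} (h : Dm G S (K + m)) (hU : U ⊆ S)
    (hm : U.card ≤ m) : Dm G (S.filter (fun v => ∀ u ∈ U, G.adj v u)) K := by
  intro X hXS hX
  obtain ⟨v, hv, hvx⟩ := h (X ∪ U) (Finset.union_subset (hXS.trans (Finset.filter_subset _ _)) hU)
    ((Finset.card_union_le _ _).trans_lt (by omega))
  exact ⟨v, Finset.mem_filter.2 ⟨hv, fun u hu => hvx u (Finset.mem_union_right _ hu)⟩,
    fun x hx => hvx x (Finset.mem_union_left _ hx)⟩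

theorem meets_class {c : ℕ} {A : Finset G.V} (C : Fin c → Set G.V)
    (h1 : ∀ i, G.IsTransitiveSet (C i)) (h2 : (A : Set G.V) ⊆ ⋃ i, C i)
    (hA : c ≤ G.chiOn (A : Set G.V)) (i : Fin c) : ∃ a ∈ A, a ∈ C i := by
  by_contra hcon
  push Not at hcon
  obtain ⟨n, rfl⟩ : ∃ n, c = n + 1 := ⟨c - 1, by have := i.2; omega⟩
  have : G.chiOn (A : Set G.V) ≤ n := by
    refine chi_le_of G (fun j => C (i.succAbove j)) (fun j => h1 _) ?_
    intro a ha
    obtain ⟨j, hj⟩ := Set.mem_iUnion.1 (h2 ha)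
    have hne : j ≠ i := by
      rintro rfl
      exact hcon a ha hj
    obtain ⟨l, rfl⟩ := Fin.exists_succAbove_eq hne
    exact Set.mem_iUnion.2 ⟨l, hj⟩
  omega

theorem hstep (c K k : ℕ) (hc : 1 ≤ c)
    (ih : ∀ (G : Tournament) (S : Finset G.V), Dm G S K →
      ∃ A ⊆ S, A.card ≤ k ∧ c ≤ G.chiOn (A : Set G.V)) :
    ∀ (G : Tournament) (S : Finset G.V), Dm G S (K + c * (K + k)) →
      ∃ A ⊆ S, A.card ≤ k + c * (K + k) + 2 ^ (c * (K + k)) * k ∧ c + 1 ≤ G.chiOn (A : Set G.V) := by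
  intro G S hS
  set w := c * (K + k) with hw
  -- a minimal dominating set
  let P : Finset G.V → Prop := fun D => D ⊆ S ∧ ¬ ∃ v ∈ S, ∀ x ∈ D, G.adj v x
  have hPS : P S := ⟨subset_rfl, fun ⟨v, hv, h⟩ => irrefl G v (h v hv)⟩
  obtain ⟨D, hD, hmin⟩ := Finset.exists_min_image (Finset.univ.filter P) Finset.card
    ⟨S, by simpa using hPS⟩
  have hD' : P D := by simpa using hD
  have hmin' : ∀ X ⊆ S, X.card < D.card → ∃ v ∈ S, ∀ x ∈ X, G.adj v x := by
    intro X hX hlt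
    by_contra hcon
    have := hmin X (by simpa using ⟨hX, hcon⟩)
    omega
  have hDcard : K + w ≤ D.card := by
    by_contra hlt
    exact hD'.2 (hS D hD'.1 (by omega))
  obtain ⟨W, hWD, hWc⟩ := Finset.exists_subset_card_eq (show w ≤ D.card by omega)
  obtain ⟨A, hAS, hAk, hAc⟩ := ih G _ (hS.restrict (hWD.trans hD'.1) hWc.le)
  have hAW : To G A W := fun a ha => (Finset.mem_filter.1 (hAS ha)).2
  have hAS' : A ⊆ S := hAS.trans (Finset.filter_subset _ _)
  have key : ∀ T : Finset G.V, ∃ B ⊆ S, B.card ≤ k ∧ (T ⊆ W → T.card = K + k →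
      c ≤ G.chiOn (B : Set G.V) ∧ To G B A ∧ ∀ v ∈ B, ∃ t ∈ T, G.adj t v) := by
    intro T
    by_cases hT : T ⊆ W ∧ T.card = K + k
    swap
    · exact ⟨∅, by simp, by simp, fun h1 h2 => absurd ⟨h1, h2⟩ hT⟩
    obtain ⟨hTW, hTc⟩ := hT
    have hTD := hTW.trans hWD
    have hN : Dm G (S.filter (fun v => (∀ d ∈ D \ T, G.adj v d) ∧ ∀ a ∈ A, G.adj v a)) K := by
      intro X hXS hX
      have hcard : ((D \ T) ∪ A ∪ X).card < D.card := by
        have h1 := Finset.card_union_le ((D \ T) ∪ A) X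
        have h2 := Finset.card_union_le (D \ T) A
        have h3 := Finset.card_sdiff_add_card_eq_card hTD
        omega
      obtain ⟨v, hv, hvx⟩ := hmin' _ (Finset.union_subset (Finset.union_subset
        (Finset.sdiff_subset.trans hD'.1) hAS') (hXS.trans (Finset.filter_subset _ _))) hcard
      refine ⟨v, Finset.mem_filter.2 ⟨hv, fun d hd => hvx d ?_, fun a ha => hvx a ?_⟩,
        fun x hx => hvx x ?_⟩
      · exact Finset.mem_union_left _ (Finset.mem_union_left _ hd)
      · exact Finset.mem_union_left _ (Finset.mem_union_right _ ha)
      · exact Finset.mem_union_right _ hx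
    obtain ⟨B, hBS, hBk, hBc⟩ := ih G _ hN
    refine ⟨B, hBS.trans (Finset.filter_subset _ _), hBk, fun _ _ => ⟨hBc, ?_, ?_⟩⟩
    · intro v hv
      exact (Finset.mem_filter.1 (hBS hv)).2.2
    · intro v hv
      obtain ⟨hvS, hvD, hvA⟩ := Finset.mem_filter.1 (hBS hv)
      by_contra hcon
      push Not at hcon
      refine hD'.2 ⟨v, hvS, fun x hx => ?_⟩
      by_cases hxT : x ∈ T
      · refine (G.total v x ?_).resolve_right (hcon x hxT)
        rintro rfl
        obtain ⟨a, ha⟩ := chi_nonempty G (hc.trans hAc)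
        exact G.asymm _ _ (hvA a ha) (hAW a ha v (hTW hxT))
      · exact hvD x (Finset.mem_sdiff.2 ⟨hx, hxT⟩)
  choose B hBS hBk hB using key
  refine ⟨A ∪ W ∪ W.powerset.biUnion B, ?_, ?_, ?_⟩
  · refine Finset.union_subset (Finset.union_subset hAS' (hWD.trans hD'.1)) ?_
    exact Finset.biUnion_subset.2 (fun T _ => hBS T)
  · have h1 := Finset.card_union_le (A ∪ W) (W.powerset.biUnion B)
    have h2 := Finset.card_union_le A W
    have h3 : (W.powerset.biUnion B).card ≤ W.powerset.card * k :=
      Finset.card_biUnion_le_card_mul _ _ _ (fun T _ => hBk T)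
    rw [Finset.card_powerset, hWc] at h3
    omega
  · by_contra hlt
    have hle : G.chiOn (↑(A ∪ W ∪ W.powerset.biUnion B) : Set G.V) ≤ c := by omega
    have hge : c ≤ G.chiOn (↑(A ∪ W ∪ W.powerset.biUnion B) : Set G.V) :=
      hAc.trans (chi_mono G (by intro a ha; simp only [Finset.coe_union]; exact Or.inl (Or.inl ha)))
    have hex : ∃ C : Fin c → Set G.V, (∀ i, G.IsTransitiveSet (C i)) ∧
        (↑(A ∪ W ∪ W.powerset.biUnion B) : Set G.V) ⊆ ⋃ i, C i := by
      rw [← le_antisymm hle hge]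
      exact chi_attained G _
    obtain ⟨C, hC1, hC2⟩ := hex
    obtain ⟨i, hi⟩ : ∃ i, K + k ≤ (W.filter (fun v => v ∈ C i)).card := by
      by_contra hcon
      push Not at hcon
      have h1 : W ⊆ Finset.univ.biUnion (fun i => W.filter (fun v => v ∈ C i)) := by
        intro v hv
        have : v ∈ ⋃ i, C i := hC2 (by simp [hv])
        obtain ⟨i, hi⟩ := Set.mem_iUnion.1 this
        simp only [Finset.mem_biUnion, Finset.mem_univ, true_and, Finset.mem_filter]
        exact ⟨i, hv, hi⟩
      have h2 := (Finset.card_le_card h1).trans Finset.card_biUnion_le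
      have h3 : ∑ i : Fin c, (W.filter (fun v => v ∈ C i)).card < ∑ i : Fin c, (K + k) :=
        Finset.sum_lt_sum_of_nonempty ⟨⟨0, hc⟩, Finset.mem_univ _⟩ (fun i _ => hcon i)
      simp only [Finset.sum_const, Finset.card_univ, Fintype.card_fin, smul_eq_mul] at h3
      omega
    obtain ⟨T, hT, hTc⟩ := Finset.exists_subset_card_eq hi
    have hTW : T ⊆ W := hT.trans (Finset.filter_subset _ _)
    obtain ⟨hBc, hBA, hBT⟩ := hB T hTW hTc
    obtain ⟨a, ha, hai⟩ := meets_class G C hC1 ((Finset.coe_subset.2 (by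
      intro x hx; simp [hx])).trans hC2) hAc i
    obtain ⟨v, hv, hvi⟩ := meets_class G C hC1 ((Finset.coe_subset.2 (by
      intro x hx
      refine Finset.mem_union_right _ (Finset.mem_biUnion.2 ⟨T, Finset.mem_powerset.2 hTW, hx⟩))).trans
        hC2) hBc i
    obtain ⟨t, ht, htv⟩ := hBT v hv
    exact hC1 i t (Finset.mem_filter.1 (hT ht)).2 v hvi a hai htv (hBA v hv a ha)
      (hAW a ha t (hTW ht))

theorem lemmaH (c : ℕ) : ∃ K k : ℕ, ∀ (G : Tournament) (S : Finset G.V), Dm G S K →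
    ∃ A ⊆ S, A.card ≤ k ∧ c ≤ G.chiOn (A : Set G.V) := by
  induction c with
  | zero => exact ⟨0, 0, fun G S _ => ⟨∅, by simp⟩⟩
  | succ c ih =>
    obtain ⟨K, k, h⟩ := ih
    rcases Nat.eq_zero_or_pos c with rfl | hc
    · refine ⟨1, 1, fun G S hS => ?_⟩
      obtain ⟨v, hv, _⟩ := hS ∅ (by simp) (by simp)
      refine ⟨{v}, by simpa using hv, by simp, ?_⟩
      by_contra hlt
      obtain ⟨C, _, h2⟩ := chi_attained G (↑({v} : Finset G.V) : Set G.V)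
      have : v ∈ ⋃ i, C i := h2 (by simp)
      obtain ⟨i, _⟩ := Set.mem_iUnion.1 this
      have := i.2
      omega
    · exact ⟨_, _, hstep c K k hc h⟩

theorem lemmaH' (c : ℕ) : ∃ K k : ℕ, ∀ (G : Tournament) (u : ℕ), Dm G Finset.univ (K + u) →
    ∀ U : Finset G.V, U.card ≤ u →
    ∃ A : Finset G.V, A.card ≤ k ∧ c ≤ G.chiOn (A : Set G.V) ∧ To G A U := by
  obtain ⟨K, k, h⟩ := lemmaH c
  refine ⟨K, k, fun G u hG U hU => ?_⟩
  obtain ⟨A, hA, hk, hc⟩ := h G _ (hG.restrict (Finset.subset_univ U) hU)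
  exact ⟨A, hk, hc, fun a ha => (Finset.mem_filter.1 (hA ha)).2⟩

theorem minimax_aux {ι κ : Type} [Fintype ι] [Fintype κ] [Nonempty ι] [Nonempty κ]
    (M : ι → κ → ℝ) : ∃ a ∈ stdSimplex ℝ ι, ∃ b ∈ stdSimplex ℝ κ,
      ∀ x ∈ stdSimplex ℝ ι, ∀ y ∈ stdSimplex ℝ κ,
        ∑ i, ∑ j, a i * y j * M i j ≤ ∑ i, ∑ j, x i * b j * M i j := by
  have hl : ∀ y : κ → ℝ, ∃ L : (ι → ℝ) →ₗ[ℝ] ℝ, ∀ x, L x = ∑ i, ∑ j, x i * y j * M i j := by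
    intro y
    refine ⟨⟨⟨fun x => ∑ i, ∑ j, x i * y j * M i j, ?_⟩, ?_⟩, fun x => rfl⟩
    · intro x x'
      simp only [Pi.add_apply, add_mul, Finset.sum_add_distrib]
    · intro r x
      simp only [Pi.smul_apply, smul_eq_mul, RingHom.id_apply, Finset.mul_sum, mul_assoc]
  have hr : ∀ x : ι → ℝ, ∃ L : (κ → ℝ) →ₗ[ℝ] ℝ, ∀ y, L y = ∑ i, ∑ j, x i * y j * M i j := by
    intro x
    refine ⟨⟨⟨fun y => ∑ i, ∑ j, x i * y j * M i j, ?_⟩, ?_⟩, fun x => rfl⟩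
    · intro y y'
      simp only [Pi.add_apply, add_mul, mul_add, Finset.sum_add_distrib]
    · intro r y
      simp only [Pi.smul_apply, smul_eq_mul, RingHom.id_apply, Finset.mul_sum]
      exact Finset.sum_congr rfl fun i _ => Finset.sum_congr rfl fun j _ => by ring
  exact Sion.exists_isSaddlePointOn (X := stdSimplex ℝ ι) (Y := stdSimplex ℝ κ)
    (f := fun x y => ∑ i, ∑ j, x i * y j * M i j)
    ⟨_, single_mem_stdSimplex ℝ (Classical.arbitrary ι)⟩ (convex_stdSimplex ℝ ι) (isCompact_stdSimplex ℝ ι)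
    (fun y _ => by refine LowerSemicontinuous.lowerSemicontinuousOn (Continuous.lowerSemicontinuous ?_) _; fun_prop)
    (fun y _ => by
      obtain ⟨L, hL⟩ := hl y
      simp_rw [← hL]
      exact (L.convexOn (convex_stdSimplex ℝ ι)).quasiconvexOn)
    (convex_stdSimplex ℝ κ) ⟨_, single_mem_stdSimplex ℝ (Classical.arbitrary κ)⟩
    (isCompact_stdSimplex ℝ κ)
    (fun y _ => by refine UpperSemicontinuous.upperSemicontinuousOn (Continuous.upperSemicontinuous ?_) _; fun_prop)
    (fun x _ => by
      obtain ⟨L, hL⟩ := hr x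
      simp_rw [← hL]
      exact (L.concaveOn (convex_stdSimplex ℝ κ)).quasiconcaveOn)

theorem extend_weight {α : Type} (s : Finset α) (p : s → ℝ) (hp : p ∈ stdSimplex ℝ s) :
    ∃ w : α → ℝ, (∀ a, 0 ≤ w a) ∧ ∑ a ∈ s, w a = 1 ∧ ∀ a : s, w a = p a := by
  have hw : ∀ a : s, (fun a => if h : a ∈ s then p ⟨a, h⟩ else 0 : α → ℝ) a = p a := by
    intro a
    simp
  refine ⟨fun a => if h : a ∈ s then p ⟨a, h⟩ else 0, ?_, ?_, hw⟩
  · intro a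
    by_cases h : a ∈ s
    · simpa [h] using hp.1 ⟨a, h⟩
    · simp [h]
  · rw [← Finset.sum_coe_sort s, ← hp.2]
    exact Finset.sum_congr rfl fun a _ => hw a

theorem minimax_fin {α β : Type} (s : Finset α) (t : Finset β) (hs : s.Nonempty) (ht : t.Nonempty)
    (R : α → β → Prop) :
    (∃ w : α → ℝ, (∀ a, 0 ≤ w a) ∧ ∑ a ∈ s, w a = 1 ∧
      ∀ b ∈ t, (1 / 2 : ℝ) ≤ ∑ a ∈ s, if R a b then w a else 0) ∨
    (∃ w : β → ℝ, (∀ b, 0 ≤ w b) ∧ ∑ b ∈ t, w b = 1 ∧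
      ∀ a ∈ s, (1 / 2 : ℝ) ≤ ∑ b ∈ t, if ¬ R a b then w b else 0) := by
  have : Nonempty s := hs.to_subtype
  have : Nonempty t := ht.to_subtype
  let M : s → t → ℝ := fun a b => if ¬ R a b then 1 else 0
  obtain ⟨a, ha, b, hb, h⟩ := minimax_aux M
  obtain ⟨w, hw1, hw2, hw3⟩ := extend_weight s a ha
  obtain ⟨w', hw1', hw2', hw3'⟩ := extend_weight t b hb
  have h' : ∀ (i : s) (j : t), ∑ i, a i * M i j ≤ ∑ j, b j * M i j := by
    intro i j
    have := h _ (single_mem_stdSimplex ℝ i) _ (single_mem_stdSimplex ℝ j)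
    simpa [Pi.single_apply] using this
  by_cases hc : ∀ i : s, (1 / 2 : ℝ) ≤ ∑ j, b j * M i j
  · right
    refine ⟨w', hw1', hw2', fun i hi => ?_⟩
    refine (hc ⟨i, hi⟩).trans_eq ?_
    rw [← Finset.sum_coe_sort t]
    refine Finset.sum_congr rfl fun j _ => ?_
    simp only [M, hw3', mul_ite, mul_one, mul_zero]
  · left
    push Not at hc
    obtain ⟨i, hi⟩ := hc
    refine ⟨w, hw1, hw2, fun j hj => ?_⟩
    have h1 := (h' i ⟨j, hj⟩).trans_lt hi
    have h2 : (∑ x ∈ s, if R x j then w x else 0) + ∑ i, a i * M i ⟨j, hj⟩ = 1 := by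
      rw [← hw2, ← Finset.sum_coe_sort s, ← Finset.sum_coe_sort s, ← Finset.sum_add_distrib]
      refine Finset.sum_congr rfl fun x _ => ?_
      by_cases hR : R x j <;> simp [M, hw3, hR]
    linarith

/-- no large triangle -/
def NT (c k : ℕ) : Prop := ∀ P Q R : Finset G.V, P.card ≤ k → Q.card ≤ k → R.card ≤ k →
  c ≤ G.chiOn (P : Set G.V) → c ≤ G.chiOn (Q : Set G.V) → c ≤ G.chiOn (R : Set G.V) →
  To G P Q → To G Q R → ¬ To G R P

/-- the event `E(X,U)` -/
def Ev (c cs : ℕ) (X U : Finset G.V) : Prop :=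
  ∃ X' ⊆ X, cs ≤ G.chiOn (X' : Set G.V) ∧ ∀ P ⊆ U, ∀ X'' ⊆ X', c ≤ G.chiOn (P : Set G.V) →
    c ≤ G.chiOn (X'' : Set G.V) → ¬ To G P X''

theorem Ev.mono {G : Tournament} {c cs : ℕ} {X U U' : Finset G.V} (h : Ev G c cs X U)
    (hU : U' ⊆ U) : Ev G c cs X U' := by
  obtain ⟨X', h1, h2, h3⟩ := h
  exact ⟨X', h1, h2, fun P hP => h3 P (hP.trans hU)⟩

theorem sum_ite_mono {α : Type} (s : Finset α) (w : α → ℝ) (hw : ∀ a, 0 ≤ w a) (p q : α → Prop)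
    {_ : DecidablePred p} {_ : DecidablePred q}
    (h : ∀ a ∈ s, p a → q a) :
    (∑ a ∈ s, if p a then w a else 0) ≤ ∑ a ∈ s, if q a then w a else 0 := by
  refine Finset.sum_le_sum fun a ha => ?_
  by_cases hp : p a
  · simp [hp, h a ha hp]
  · simp only [hp, if_false]
    split_ifs
    · exact hw a
    · exact le_rfl

theorem lemmaL (c cs : ℕ) (hc : 1 ≤ c) (hcs : 1 ≤ cs) : ∃ K kL : ℕ,
    ∀ (G : Tournament) (u k : ℕ), u ≤ k → kL ≤ k → Dm G Finset.univ (K + u) → NT G c k →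
    ∃ (s : Finset (Finset G.V)) (w : Finset G.V → ℝ), (∀ X ∈ s, X.card ≤ kL) ∧
      (∀ X, 0 ≤ w X) ∧ ∑ X ∈ s, w X = 1 ∧
      ∀ U : Finset G.V, U.card ≤ u → (1 / 2 : ℝ) ≤ ∑ X ∈ s, if Ev G c cs X U then w X else 0 := by
  obtain ⟨K₀, k₀, H₀⟩ := lemmaH' (cs + c)
  set c' := cs * 2 ^ k₀ + k₀ with hc'
  obtain ⟨K₁, k₁, H₁⟩ := lemmaH' (c' + (c * 2 ^ k₀ + k₀))
  refine ⟨max K₀ K₁, max k₀ k₁, fun G u k huk hkk hG hNT => ?_⟩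
  have hG₀ : Dm G Finset.univ (K₀ + u) := fun X hX hlt =>
    hG X hX (hlt.trans_le (by have := le_max_left K₀ K₁; omega))
  have hG₁ : Dm G Finset.univ (K₁ + u) := fun X hX hlt =>
    hG X hX (hlt.trans_le (by have := le_max_right K₀ K₁; omega))
  have hk₀ : k₀ ≤ k := (le_max_left _ _).trans hkk
  have hk₁ : k₁ ≤ k := (le_max_right _ _).trans hkk
  replace H₀ := H₀ G u hG₀
  replace H₁ := H₁ G u hG₁
  let SY : Finset (Finset G.V) :=
    Finset.univ.filter fun Y => Y.card ≤ k₀ ∧ cs + c ≤ G.chiOn (Y : Set G.V)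
  let SX : Finset (Finset G.V) :=
    Finset.univ.filter fun X => X.card ≤ k₁ ∧ c' + (c * 2 ^ k₀ + k₀) ≤ G.chiOn (X : Set G.V)
  have hSY : ∀ Y, Y ∈ SY ↔ Y.card ≤ k₀ ∧ cs + c ≤ G.chiOn (Y : Set G.V) := by simp [SY]
  have hSX : ∀ X, X ∈ SX ↔ X.card ≤ k₁ ∧ c' + (c * 2 ^ k₀ + k₀) ≤ G.chiOn (X : Set G.V) := by
    simp [SX]
  have hYne : SY.Nonempty := by
    obtain ⟨Y, h1, h2, _⟩ := H₀ ∅ (by simp)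
    exact ⟨Y, (hSY Y).2 ⟨h1, h2⟩⟩
  have hXne : SX.Nonempty := by
    obtain ⟨Y, h1, h2, _⟩ := H₁ ∅ (by simp)
    exact ⟨Y, (hSX Y).2 ⟨h1, h2⟩⟩
  let In : Finset G.V → G.V → Prop := fun Y v => c ≤ G.chiOn (↑(Y.filter (fun y => G.adj v y)) : Set G.V)
  rcases minimax_fin SY SX hYne hXne
    (fun Y X => G.chiOn (↑(X.filter (In Y)) : Set G.V) < c') with
    ⟨w, hw1, hw2, hw3⟩ | ⟨w, hw1, hw2, hw3⟩
  · refine ⟨SY, w, fun Y hY => ((hSY Y).1 hY).1.trans (le_max_left _ _), hw1, hw2, fun U hU => ?_⟩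
    obtain ⟨X, hXk, hXc, hXU⟩ := H₁ U hU
    refine (hw3 X ((hSX X).2 ⟨hXk, hXc⟩)).trans (sum_ite_mono _ _ hw1 _ _ fun Y hY hR => ?_)
    obtain ⟨hYk, hYc⟩ := (hSY Y).1 hY
    have h1 := chi_filter G X (In Y)
    obtain ⟨X₂, hX₂, Q, hQ, hX₂c, hQX, hXQ⟩ := trace_lemma G c k₀ hc
      (X.filter (fun x => ¬ In Y x)) Y hYk (by omega)
    have hX₂X : X₂ ⊆ X := hX₂.trans (Finset.filter_subset _ _)
    obtain ⟨v, hv⟩ := chi_nonempty G (hc.trans hX₂c)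
    have hvI : G.chiOn (↑(Y.filter (fun y => G.adj v y)) : Set G.V) < c :=
      not_le.1 (Finset.mem_filter.1 (hX₂ hv)).2
    have h2 : G.chiOn (↑(Y \ Q) : Set G.V) < c := by
      refine lt_of_le_of_lt (chi_mono G (Finset.coe_subset.2 ?_)) hvI
      intro y hy
      exact Finset.mem_filter.2 ⟨(Finset.mem_sdiff.1 hy).1, hXQ v hv y hy⟩
    have h3 := chi_sdiff G Y Q
    rw [Finset.inter_eq_right.2 hQ] at h3
    refine ⟨Q, hQ, by omega, fun P hP Q' hQ' hPc hQc hPQ => ?_⟩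
    refine hNT P Q' X₂ ?_ ?_ ?_ hPc hQc hX₂c hPQ (hQX.mono hQ' subset_rfl) (hXU.mono hX₂X hP)
    · exact (Finset.card_le_card hP).trans (hU.trans huk)
    · exact (Finset.card_le_card (hQ'.trans hQ)).trans (hYk.trans hk₀)
    · exact (Finset.card_le_card hX₂X).trans (hXk.trans hk₁)
  · refine ⟨SX, w, fun Y hY => ((hSX Y).1 hY).1.trans (le_max_right _ _), hw1, hw2, fun U hU => ?_⟩
    obtain ⟨Y, hYk, hYc, hYU⟩ := H₀ U hU
    refine (hw3 Y ((hSY Y).2 ⟨hYk, hYc⟩)).trans (sum_ite_mono _ _ hw1 _ _ fun X hX hR => ?_)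
    obtain ⟨hXk, hXc⟩ := (hSX X).1 hX
    obtain ⟨X₂, hX₂, Q, hQ, hX₂c, hQX, hXQ⟩ := trace_lemma G cs k₀ hcs
      (X.filter (In Y)) Y hYk (by omega)
    have hX₂X : X₂ ⊆ X := hX₂.trans (Finset.filter_subset _ _)
    obtain ⟨v, hv⟩ := chi_nonempty G (hcs.trans hX₂c)
    have hvI : c ≤ G.chiOn (↑(Y.filter (fun y => G.adj v y)) : Set G.V) :=
      (Finset.mem_filter.1 (hX₂ hv)).2
    have h2 : c ≤ G.chiOn (↑(Y \ Q) : Set G.V) := by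
      refine hvI.trans (chi_mono G (Finset.coe_subset.2 ?_))
      intro y hy
      obtain ⟨hy1, hy2⟩ := Finset.mem_filter.1 hy
      exact Finset.mem_sdiff.2 ⟨hy1, fun hyQ => G.asymm _ _ hy2 (hQX y hyQ v hv)⟩
    refine ⟨X₂, hX₂X, hX₂c, fun P hP X' hX' hPc hXc' hPX => ?_⟩
    refine hNT P X' (Y \ Q) ?_ ?_ ?_ hPc hXc' h2 hPX (hXQ.mono hX' subset_rfl)
      (hYU.mono Finset.sdiff_subset hP)
    · exact (Finset.card_le_card hP).trans (hU.trans huk)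
    · exact (Finset.card_le_card (hX'.trans hX₂X)).trans (hXk.trans hk₁)
    · exact (Finset.card_le_card Finset.sdiff_subset).trans (hYk.trans hk₀)

theorem ev_excl (c kX : ℕ) (hc : 1 ≤ c) (X Z : Finset G.V) (hX : X.card ≤ kX)
    (h1 : Ev G c (2 * c) X Z) (h2 : Ev G c (c * 2 ^ kX + kX) Z X) : False := by
  obtain ⟨X', hX', hXc, hE⟩ := h1
  obtain ⟨Z', hZ', hZc, hF⟩ := h2
  obtain ⟨Z₂, hZ₂, Q, hQ, hZ₂c, hQZ, hZQ⟩ := trace_lemma G c kX hc Z' X'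
    ((Finset.card_le_card hX').trans hX) hZc
  have h3 := chi_sdiff G X' Q
  rw [Finset.inter_eq_right.2 hQ] at h3
  by_cases hq : c ≤ G.chiOn (Q : Set G.V)
  · exact hF Q (hQ.trans hX') Z₂ hZ₂ hq hZ₂c hQZ
  · exact hE Z₂ (hZ₂.trans hZ') (X' \ Q) Finset.sdiff_subset hZ₂c (by omega) hZQ

/-- the averaging argument -/
theorem averaging {α β : Type} (s : Finset α) (t : Finset β) (w : α → ℝ) (z : β → ℝ)
    (hw : ∀ a, 0 ≤ w a) (hw1 : ∑ a ∈ s, w a = 1)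
    (hz1 : ∑ b ∈ t, z b = 1) (hz : ∀ b, 0 ≤ z b) (E : α → β → Prop)
    (h1 : ∀ a ∈ s, (∑ b ∈ t, if E a b then z b else 0) ≤ 1 / 2)
    (h2 : ∀ b ∈ t, ∀ b' ∈ t, (1 / 2 : ℝ) ≤ ∑ a ∈ s, if E a b ∧ E a b' then w a else 0) : False := by
  have e1 : ∑ b ∈ t, ∑ b' ∈ t, z b * z b' * ∑ a ∈ s, (if E a b ∧ E a b' then w a else 0)
      = ∑ a ∈ s, w a * (∑ b ∈ t, if E a b then z b else 0) ^ 2 := by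
    have : ∀ b ∈ t, ∑ b' ∈ t, z b * z b' * ∑ a ∈ s, (if E a b ∧ E a b' then w a else 0) =
        ∑ a ∈ s, ∑ b' ∈ t, w a * ((if E a b then z b else 0) * (if E a b' then z b' else 0)) := by
      intro b _
      rw [Finset.sum_comm]
      refine Finset.sum_congr rfl fun b' _ => ?_
      rw [Finset.mul_sum]
      refine Finset.sum_congr rfl fun a _ => ?_
      by_cases h : E a b <;> by_cases h' : E a b' <;> simp [h, h']
      ring
    rw [Finset.sum_congr rfl this, Finset.sum_comm]
    refine Finset.sum_congr rfl fun a _ => ?_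
    rw [sq, Finset.sum_mul_sum, Finset.mul_sum]
    exact Finset.sum_congr rfl fun b _ => by rw [Finset.mul_sum]
  have e2 : (1 / 2 : ℝ) ≤ ∑ b ∈ t, ∑ b' ∈ t, z b * z b' *
      ∑ a ∈ s, (if E a b ∧ E a b' then w a else 0) := by
    have e3 : ∑ b ∈ t, ∑ b' ∈ t, z b * z b' * (1 / 2 : ℝ) = 1 / 2 := by
      simp_rw [← Finset.sum_mul, ← Finset.mul_sum, hz1]
      simp [hz1]
    rw [← e3]
    refine Finset.sum_le_sum fun b hb => Finset.sum_le_sum fun b' hb' => ?_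
    exact mul_le_mul_of_nonneg_left (h2 b hb b' hb') (mul_nonneg (hz b) (hz b'))
  have e4 : ∑ a ∈ s, w a * (∑ b ∈ t, if E a b then z b else 0) ^ 2 ≤ ∑ a ∈ s, w a * (1 / 4) := by
    refine Finset.sum_le_sum fun a ha => mul_le_mul_of_nonneg_left ?_ (hw a)
    have := h1 a ha
    have h0 : 0 ≤ ∑ b ∈ t, if E a b then z b else 0 :=
      Finset.sum_nonneg fun b _ => by split_ifs; exacts [hz b, le_rfl]
    nlinarith
  rw [← Finset.sum_mul, hw1] at e4
  linarith

theorem main (c : ℕ) (hc : 1 ≤ c) : ∃ K k : ℕ, ∀ G : Tournament, K ≤ G.dom → ¬ NT G c k := by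
  obtain ⟨KX, kX, HX⟩ := lemmaL c (2 * c) hc (by omega)
  obtain ⟨KZ, kZ, HZ⟩ := lemmaL c (c * 2 ^ kX + kX) hc
    (by have : 0 < c * 2 ^ kX := by positivity
        omega)
  refine ⟨KX + 2 * kZ + (KZ + kX), 2 * kZ + kX, fun G hG hNT => ?_⟩
  have hD := Dm_of_dom G hG
  obtain ⟨s, w, hs, hw, hw1, hE⟩ := HX G (2 * kZ) (2 * kZ + kX) (by omega) (by omega)
    (fun X hX hlt => hD X hX (by omega)) hNT
  obtain ⟨t, z, ht, hz, hz1, hF⟩ := HZ G kX (2 * kZ + kX) (by omega) (by omega)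
    (fun X hX hlt => hD X hX (by omega)) hNT
  refine averaging s t w z hw hw1 hz1 hz (fun X Z => Ev G c (2 * c) X Z) ?_ ?_
  · intro X hX
    have h1 := hF X (hs X hX)
    have h2 : (∑ Z ∈ t, if Ev G c (2 * c) X Z then z Z else 0) +
        (∑ Z ∈ t, if Ev G c (c * 2 ^ kX + kX) Z X then z Z else 0) ≤ 1 := by
      rw [← hz1, ← Finset.sum_add_distrib]
      refine Finset.sum_le_sum fun Z _ => ?_
      by_cases ha : Ev G c (2 * c) X Z <;> by_cases hb : Ev G c (c * 2 ^ kX + kX) Z X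
      · exact (ev_excl G c kX hc X Z (hs X hX) ha hb).elim
      · simp [ha, hb]
      · simp [ha, hb]
      · simpa [ha, hb] using hz Z
    linarith
  · intro Z hZ Z' hZ'
    refine (hE (Z ∪ Z') ?_).trans (sum_ite_mono _ _ hw _ _ fun X _ h => ?_)
    · have := Finset.card_union_le Z Z'
      have := ht Z hZ
      have := ht Z' hZ'
      omega
    · exact ⟨h.mono Finset.subset_union_left, h.mono Finset.subset_union_right⟩

end BigTri

/-- For every `c` there are `K, k` such that every tournament with domination number
at least `K` has three disjoint sets `A, B, C` of at most `k` vertices, each of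
chromatic number at least `c`, with `A ⇒ B ⇒ C ⇒ A`. -/
theorem big_triangle (c : ℕ) :
    ∃ K k : ℕ, ∀ G : Tournament, K ≤ G.dom →
      ∃ A B C : Finset G.V,
        Disjoint A B ∧ Disjoint B C ∧ Disjoint A C ∧
        A.card ≤ k ∧ B.card ≤ k ∧ C.card ≤ k ∧
        c ≤ G.chiOn ↑A ∧ c ≤ G.chiOn ↑B ∧ c ≤ G.chiOn ↑C ∧
        G.CompleteTo ↑A ↑B ∧ G.CompleteTo ↑B ↑C ∧ G.CompleteTo ↑C ↑A := by
  obtain ⟨K, k, h⟩ := BigTri.main (c + 1) (by omega)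
  refine ⟨K, k, fun G hG => ?_⟩
  by_contra hcon
  refine h G hG fun P Q R hP hQ hR hPc hQc hRc hPQ hQR hRP => hcon ?_
  exact ⟨P, Q, R, hPQ.disj, hQR.disj, hRP.disj.symm, hP, hQ, hR, by omega, by omega, by omega,
    fun a ha b hb => hPQ a ha b hb, fun a ha b hb => hQR a ha b hb, fun a ha b hb => hRP a ha b hb⟩
end

section
/- Let H be a rebel and let K be a transitive tournament. Then Δ(H,K,K) is a rebel. -/
namespace Tournament

/-- The one-vertex tournament. -/
def oneT : Tournament where
  V := PUnit
  fintype := inferInstance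
  adj _ _ := False
  asymm := by intro u v h; exact h.elim
  total := by intro u v h; cases u; cases v; exact absurd rfl h

/-- `Δ(H1,H2,H3)`: disjoint copies of `H1,H2,H3` with `A1 ⇒ A2 ⇒ A3 ⇒ A1`. -/
def delta (H1 H2 H3 : Tournament) : Tournament where
  V := H1.V ⊕ H2.V ⊕ H3.V
  fintype := inferInstance
  adj x y :=
    match x, y with
    | .inl a, .inl b => H1.adj a b
    | .inl _, .inr (.inl _) => True
    | .inl _, .inr (.inr _) => False
    | .inr (.inl _), .inl _ => False
    | .inr (.inl a), .inr (.inl b) => H2.adj a b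
    | .inr (.inl _), .inr (.inr _) => True
    | .inr (.inr _), .inl _ => True
    | .inr (.inr _), .inr (.inl _) => False
    | .inr (.inr a), .inr (.inr b) => H3.adj a b
  asymm := by
    rintro (a | a | a) (b | b | b) h <;> simp only at h ⊢ <;>
      first
        | exact H1.asymm _ _ h
        | exact H2.asymm _ _ h
        | exact H3.asymm _ _ h
        | exact h
        | exact fun h' => h'
  total := by
    rintro (a | a | a) (b | b | b) h <;> simp only at h ⊢ <;>
      first
        | exact H1.total _ _ (by simpa using h)
        | exact H2.total _ _ (by simpa using h)
        | exact H3.total _ _ (by simpa using h)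
        | exact Or.inl trivial
        | exact Or.inr trivial

/-- The tournament obtained from disjoint copies of `H1, H2` by directing
all edges from the copy of `H1` to the copy of `H2`. -/
def join2 (H1 H2 : Tournament) : Tournament where
  V := H1.V ⊕ H2.V
  fintype := inferInstance
  adj x y :=
    match x, y with
    | .inl a, .inl b => H1.adj a b
    | .inl _, .inr _ => True
    | .inr _, .inl _ => False
    | .inr a, .inr b => H2.adj a b
  asymm := by
    rintro (a | a) (b | b) h <;> simp only at h ⊢ <;>
      first
        | exact H1.asymm _ _ h
        | exact H2.asymm _ _ h
        | exact h
        | exact fun h' => h'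
  total := by
    rintro (a | a) (b | b) h <;> simp only at h ⊢ <;>
      first
        | exact H1.total _ _ (by simpa using h)
        | exact H2.total _ _ (by simpa using h)
        | exact Or.inl trivial
        | exact Or.inr trivial

end Tournament


namespace Tournament

theorem irrefl' (G : Tournament) (v : G.V) : ¬ G.adj v v := fun h => G.asymm v v h h

/-- A map preserving `adj` is an embedding. -/
theorem contains_of_map {G H : Tournament} (f : H.V → G.V)
    (hf : ∀ u v, H.adj u v → G.adj (f u) (f v)) : G.Contains H := by
  refine ⟨f, ?_, fun _ => trivial, fun u v => ⟨hf u v, ?_⟩⟩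
  · intro u v huv
    by_contra hne
    rcases H.total u v hne with h | h
    · have := hf _ _ h
      rw [huv] at this
      exact G.irrefl' _ this
    · have := hf _ _ h
      rw [huv] at this
      exact G.irrefl' _ this
  · intro h
    have hne : u ≠ v := by
      rintro rfl
      exact G.irrefl' _ h
    rcases H.total u v hne with h' | h'
    · exact h'
    · exact absurd (hf _ _ h') (G.asymm _ _ h)

theorem exists_dominating (G : Tournament) :
    ∃ X : Finset G.V, (∀ v, v ∉ X → ∃ x ∈ X, G.adj x v) ∧ X.card = G.dom := by
  have hne : {n | ∃ X : Finset G.V, ↑X ⊆ (Set.univ : Set G.V) ∧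
      (∀ v ∈ (Set.univ : Set G.V), v ∉ X → ∃ x ∈ X, G.adj x v) ∧ X.card = n}.Nonempty :=
    ⟨_, Finset.univ, by simp, by simp, rfl⟩
  obtain ⟨X, -, h, hc⟩ := Nat.sInf_mem hne
  exact ⟨X, fun v hv => h v trivial hv, hc⟩

theorem dom_le (G : Tournament) (X : Finset G.V)
    (h : ∀ v, v ∉ X → ∃ x ∈ X, G.adj x v) : G.dom ≤ X.card :=
  Nat.sInf_le ⟨X, by simp, fun v _ hv => h v hv, rfl⟩

/-- Induced subtournament on the set of vertices complete to `X`. -/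
noncomputable def above (G : Tournament) (X : Finset G.V) : Tournament where
  V := {v : G.V // ∀ x ∈ X, G.adj v x}
  fintype := Fintype.ofFinite _
  adj u v := G.adj u.1 v.1
  asymm u v := G.asymm u.1 v.1
  total u v h := G.total u.1 v.1 (fun h' => h (Subtype.ext h'))

theorem exists_copy_above {H : Tournament} {c : ℕ}
    (hc : ∀ G : Tournament, ¬ G.Contains H → G.dom < c)
    (G : Tournament) (X : Finset G.V) (h : c + X.card ≤ G.dom) :
    ∃ f : H.V → G.V, (∀ u v, H.adj u v → G.adj (f u) (f v)) ∧ ∀ u, ∀ x ∈ X, G.adj (f u) x := by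
  classical
  by_cases hcon : (G.above X).Contains H
  · obtain ⟨f, -, -, hf⟩ := hcon
    exact ⟨fun u => (f u).1, fun u v huv => (hf u v).1 huv, fun u => (f u).2⟩
  · exfalso
    have h1 := hc _ hcon
    obtain ⟨D, hD, hDc⟩ := (G.above X).exists_dominating
    have h2 := G.dom_le (X ∪ D.image Subtype.val) (by
      intro v hv
      rw [Finset.mem_union, not_or] at hv
      by_cases hx : ∃ x ∈ X, G.adj x v
      · obtain ⟨x, hx, hxv⟩ := hx
        exact ⟨x, Finset.mem_union_left _ hx, hxv⟩
      · push Not at hx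
        have hv' : ∀ x ∈ X, G.adj v x := by
          intro x hxX
          rcases G.total v x (by rintro rfl; exact hv.1 hxX) with h | h
          · exact h
          · exact absurd h (hx x hxX)
        obtain ⟨d, hd, hdv⟩ := hD ⟨v, hv'⟩ (by
          intro hmem
          exact hv.2 (Finset.mem_image.2 ⟨_, hmem, rfl⟩))
        exact ⟨d.1, Finset.mem_union_right _ (Finset.mem_image.2 ⟨d, hd, rfl⟩), hdv⟩)
    have h3 := Finset.card_union_le X (D.image Subtype.val)
    have h4 : (D.image Subtype.val).card ≤ D.card := Finset.card_image_le
    omega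

/-- A sequence of `s` copies of `H`, each complete to all the earlier ones. -/
def IsBlob (G H : Tournament) (s : ℕ) (f : ℕ → H.V → G.V) : Prop :=
  ∀ i < s, (∀ u v, H.adj u v → G.adj (f i u) (f i v)) ∧
    ∀ j < i, ∀ u v, G.adj (f i u) (f j v)

open Classical in
/-- The vertex set of a blob. -/
noncomputable def blobSet {G H : Tournament} (s : ℕ) (f : ℕ → H.V → G.V) : Finset G.V :=
  ((Finset.range s) ×ˢ (Finset.univ : Finset H.V)).image (fun p => f p.1 p.2)

theorem mem_blobSet {G H : Tournament} {s : ℕ} {f : ℕ → H.V → G.V} {i : ℕ} (hi : i < s)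
    (u : H.V) : f i u ∈ blobSet s f := by
  classical
  unfold blobSet
  exact Finset.mem_image.2 ⟨(i, u), by simp [hi], rfl⟩

theorem card_blobSet {G H : Tournament} (s : ℕ) (f : ℕ → H.V → G.V) :
    (blobSet s f).card ≤ s * Fintype.card H.V := by
  classical
  unfold blobSet
  refine Finset.card_image_le.trans ?_
  simp

theorem exists_blob {H : Tournament} {c : ℕ}
    (hc : ∀ G : Tournament, ¬ G.Contains H → G.dom < c)
    (G : Tournament) (X : Finset G.V) (s : ℕ)
    (h : c + X.card + s * Fintype.card H.V ≤ G.dom) :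
    ∃ f : ℕ → H.V → G.V, G.IsBlob H s f ∧ ∀ i < s, ∀ u, ∀ x ∈ X, G.adj (f i u) x := by
  classical
  induction s with
  | zero =>
    obtain ⟨f, -⟩ := exists_copy_above hc G X (by omega)
    exact ⟨fun _ => f, by intro i hi; omega, by intro i hi; omega⟩
  | succ s ih =>
    rw [Nat.succ_mul] at h
    obtain ⟨f, hf, hfX⟩ := ih (by omega)
    obtain ⟨g, hg, hgX⟩ := exists_copy_above hc G (X ∪ blobSet s f) (by
      have h1 := Finset.card_union_le X (blobSet s f)
      have h2 := card_blobSet s f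
      omega)
    refine ⟨fun i => if i = s then g else f i, ?_, ?_⟩
    · intro i hi
      by_cases his : i = s
      · subst his
        refine ⟨by simpa using hg, ?_⟩
        intro j hj u v
        have hne : j ≠ i := by omega
        simp only [if_true, hne, if_false]
        exact hgX u _ (Finset.mem_union_right _ (mem_blobSet hj v))
      · have hi' : i < s := by omega
        refine ⟨by simpa [his] using (hf i hi').1, ?_⟩
        intro j hj u v
        have hne : j ≠ s := by omega
        simp only [his, hne, if_false]
        exact (hf i hi').2 j hj u v
    · intro i hi u x hx
      by_cases his : i = s
      · simp only [his, if_true]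
        exact hgX u x (Finset.mem_union_left _ hx)
      · simp only [his, if_false]
        exact hfX i (by omega) u x hx

theorem exists_chain (G : Tournament) (n : ℕ) (S : Finset G.V) (hS : 2 ^ n ≤ S.card) :
    ∃ g : ℕ → G.V, (∀ i < n, g i ∈ S) ∧ ∀ j < n, ∀ i < j, G.adj (g i) (g j) := by
  classical
  induction n generalizing S with
  | zero =>
    have : S.Nonempty := Finset.card_pos.1 (by simpa using hS)
    obtain ⟨v, hv⟩ := this
    exact ⟨fun _ => v, by intro i hi; omega, by intro i hi; omega⟩
  | succ n ih =>
    have hpos : 0 < 2 ^ n := by positivity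
    rw [pow_succ] at hS
    have : S.Nonempty := Finset.card_pos.1 (by omega)
    obtain ⟨v, hv⟩ := this
    have hsub : S ⊆ insert v ((S.filter (fun u => G.adj v u)) ∪ (S.filter (fun u => G.adj u v))) := by
      intro u hu
      by_cases huv : v = u
      · simp [huv]
      · rcases G.total v u huv with h | h <;> simp [hu, h]
    have h1 := Finset.card_le_card hsub
    have h2 := Finset.card_insert_le v
      ((S.filter (fun u => G.adj v u)) ∪ (S.filter (fun u => G.adj u v)))
    have h3 := Finset.card_union_le (S.filter (fun u => G.adj v u)) (S.filter (fun u => G.adj u v))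
    have h4 : 2 ^ n ≤ (S.filter (fun u => G.adj v u)).card ∨
        2 ^ n ≤ (S.filter (fun u => G.adj u v)).card := by omega
    rcases h4 with h4 | h4
    · obtain ⟨g, hg, hg'⟩ := ih _ h4
      refine ⟨fun i => if i = 0 then v else g (i - 1), ?_, ?_⟩
      · intro i hi
        by_cases h0 : i = 0
        · simp [h0, hv]
        · simp only [h0, if_false]
          exact (Finset.mem_filter.1 (hg (i - 1) (by omega))).1
      · intro j hj i hij
        have hj0 : j ≠ 0 := by omega
        by_cases h0 : i = 0
        · simp only [h0, hj0, if_true, if_false]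
          exact (Finset.mem_filter.1 (hg (j - 1) (by omega))).2
        · simp only [h0, hj0, if_false]
          exact hg' _ (by omega) _ (by omega)
    · obtain ⟨g, hg, hg'⟩ := ih _ h4
      refine ⟨fun i => if i = n then v else g i, ?_, ?_⟩
      · intro i hi
        by_cases h0 : i = n
        · simp [h0, hv]
        · simp only [h0, if_false]
          exact (Finset.mem_filter.1 (hg i (by omega))).1
      · intro j hj i hij
        have hi0 : i ≠ n := by omega
        by_cases h0 : j = n
        · simp only [h0, hi0, if_true, if_false]
          exact (Finset.mem_filter.1 (hg i (by omega))).2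
        · simp only [h0, hi0, if_false]
          exact hg' _ (by omega) _ (by omega)

/-- A transitive tournament embeds in every large set of vertices. -/
theorem exists_copy_transitive {K : Tournament} (hK : K.IsTransitiveSet Set.univ)
    (G : Tournament) (S : Finset G.V) (hS : 2 ^ (Fintype.card K.V) ≤ S.card) :
    ∃ f : K.V → G.V, (∀ u v, K.adj u v → G.adj (f u) (f v)) ∧ ∀ u, f u ∈ S := by
  classical
  obtain ⟨g, hg, hg'⟩ := G.exists_chain _ S hS
  let rk : K.V → ℕ := fun v => (Finset.univ.filter (fun u => K.adj u v)).card
  have hrk : ∀ v, rk v < Fintype.card K.V := by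
    intro v
    refine Finset.card_lt_card (Finset.ssubset_univ_iff.2 ?_)
    intro h
    have := Finset.mem_univ v
    rw [← h] at this
    exact K.irrefl' v (Finset.mem_filter.1 this).2
  refine ⟨fun v => g (rk v), ?_, fun u => hg _ (hrk u)⟩
  intro u v huv
  refine hg' _ (hrk v) _ (Finset.card_lt_card ?_)
  rw [Finset.ssubset_iff_of_subset]
  · exact ⟨u, by simp [huv], by simp [K.irrefl' u]⟩
  · intro w hw
    have hw := (Finset.mem_filter.1 hw).2
    refine Finset.mem_filter.2 ⟨Finset.mem_univ _, ?_⟩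
    have hne : w ≠ v := by
      rintro rfl
      exact K.asymm _ _ huv hw
    rcases K.total w v hne with h | h
    · exact h
    · exact absurd h (hK w trivial u trivial v trivial hw huv)

theorem contains_delta {G H K : Tournament} (hK : K.IsTransitiveSet Set.univ)
    (h : H.V → G.V) (hh : ∀ u v, H.adj u v → G.adj (h u) (h v))
    (B C : Finset G.V) (hB : 2 ^ (Fintype.card K.V) ≤ B.card)
    (hC : 2 ^ (Fintype.card K.V) ≤ C.card)
    (h1 : ∀ u, ∀ b ∈ B, G.adj (h u) b) (h2 : ∀ b ∈ B, ∀ c ∈ C, G.adj b c)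
    (h3 : ∀ c ∈ C, ∀ u, G.adj c (h u)) : G.Contains (delta H K K) := by
  obtain ⟨b, hb, hbB⟩ := exists_copy_transitive hK G B hB
  obtain ⟨c, hc, hcC⟩ := exists_copy_transitive hK G C hC
  refine contains_of_map (H := delta H K K)
    (fun x : H.V ⊕ K.V ⊕ K.V => Sum.elim h (Sum.elim b c) x) ?_
  rintro (x | x | x) (y | y | y) hxy
  · exact hh _ _ hxy
  · exact h1 _ _ (hbB _)
  · exact False.elim hxy
  · exact False.elim hxy
  · exact hb _ _ hxy
  · exact h2 _ (hbB _) _ (hcC _)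
  · exact h3 _ (hcC _) _
  · exact False.elim hxy
  · exact hc _ _ hxy

open Classical in
/-- Indices of the copies in the blob to which `v` is complete. -/
noncomputable def good {G H : Tournament} (s : ℕ) (f : ℕ → H.V → G.V) (v : G.V) : Finset ℕ :=
  (Finset.range s).filter (fun i => ∀ u, G.adj v (f i u))

open Classical in
/-- Vertices complete to at least `t` copies in the blob. -/
noncomputable def upper {G H : Tournament} (s t : ℕ) (f : ℕ → H.V → G.V) : Finset G.V :=
  Finset.univ.filter (fun v => t ≤ (good s f v).card)

theorem mem_good {G H : Tournament} {s : ℕ} {f : ℕ → H.V → G.V} {v : G.V} {i : ℕ} :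
    i ∈ good s f v ↔ i < s ∧ ∀ u, G.adj v (f i u) := by
  classical
  simp [good]

theorem mem_upper {G H : Tournament} {s t : ℕ} {f : ℕ → H.V → G.V} {v : G.V} :
    v ∈ upper s t f ↔ t ≤ (good s f v).card := by
  classical
  simp [upper]

/-- The exceptional set is small. -/
theorem exceptional {G H K : Tournament} (hK : K.IsTransitiveSet Set.univ)
    [Nonempty H.V] (hG : ¬ G.Contains (delta H K K))
    (r m t s : ℕ) (hr : r = 2 ^ (Fintype.card K.V)) (hm : m = r * Fintype.card H.V)
    (hs : s = 2 * m * t) (hmt : r * Fintype.card H.V ^ m ≤ m * t) (ht : 0 < t)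
    (f f' : ℕ → H.V → G.V) (hf : G.IsBlob H s f) (hf' : G.IsBlob H s f')
    (hff : ∀ i < s, ∀ u, ∀ x ∈ blobSet s f, G.adj (f' i u) x)
    (E : Finset G.V) (hE : ∀ v ∈ E, v ∈ upper s t f' ∧ v ∉ upper s t f) :
    E.card ≤ 2 * m * m := by
  classical
  by_contra hcon
  push Not at hcon
  have hHpos : 0 < Fintype.card H.V := Fintype.card_pos
  have hrpos : 0 < r := by rw [hr]; positivity
  have hmpos : 0 < m := by rw [hm]; positivity
  -- Step 1
  have step1 : ∃ j < s, m ≤ (E.filter (fun v => j ∈ good s f' v)).card := by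
    by_contra hno
    push Not at hno
    have e1 : ∑ v ∈ E, (good s f' v).card =
        ∑ j ∈ Finset.range s, (E.filter (fun v => j ∈ good s f' v)).card := by
      have := Finset.sum_card_bipartiteAbove_eq_sum_card_bipartiteBelow
        (s := E) (t := Finset.range s) (fun v j => j ∈ good s f' v)
      refine Eq.trans ?_ this
      refine Finset.sum_congr rfl fun v _ => ?_
      congr 1
      ext j
      simp only [Finset.mem_bipartiteAbove, Finset.mem_range]
      exact ⟨fun h => ⟨(mem_good.1 h).1, h⟩, fun h => h.2⟩
    have e2 : E.card * t ≤ ∑ v ∈ E, (good s f' v).card := by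
      have := Finset.card_nsmul_le_sum E (fun v => (good s f' v).card) t
        (fun v hv => mem_upper.1 (hE v hv).1)
      simpa using this
    have e3 : ∑ j ∈ Finset.range s, (E.filter (fun v => j ∈ good s f' v)).card ≤ s * m := by
      have := Finset.sum_le_card_nsmul (Finset.range s)
        (fun j => (E.filter (fun v => j ∈ good s f' v)).card) m
        (fun j hj => (hno j (Finset.mem_range.1 hj)).le)
      simpa using this
    have e4 : E.card * t ≤ (2 * m * m) * t := by
      calc E.card * t ≤ s * m := by omega
        _ = (2 * m * m) * t := by rw [hs]; ring
    have := Nat.le_of_mul_le_mul_right e4 ht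
    omega
  obtain ⟨j, hj, hjm⟩ := step1
  obtain ⟨E', hE'sub, hE'card⟩ := Finset.exists_subset_card_eq hjm
  have hE'E : ∀ v ∈ E', v ∈ E := fun v hv => (Finset.mem_filter.1 (hE'sub hv)).1
  have hE'j : ∀ v ∈ E', ∀ u, G.adj v (f' j u) := fun v hv =>
    (mem_good.1 (Finset.mem_filter.1 (hE'sub hv)).2).2
  -- Step 2
  let I : Finset ℕ := Finset.range s \ E'.biUnion (fun v => good s f v)
  have hIcard : m * t ≤ I.card := by
    have a1 : (E'.biUnion (fun v => good s f v)).card ≤ m * t := by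
      rw [← hE'card]
      refine Finset.card_biUnion_le_card_mul _ _ _ ?_
      intro v hv
      have := (hE v (hE'E v hv)).2
      rw [mem_upper] at this
      omega
    have a2 := Finset.le_card_sdiff (E'.biUnion (fun v => good s f v)) (Finset.range s)
    rw [Finset.card_range] at a2
    have a3 : s = m * t + m * t := by rw [hs]; ring
    show m * t ≤ (Finset.range s \ E'.biUnion (fun v => good s f v)).card
    omega
  have hbad : ∀ i v, ∃ u, i ∈ I → v ∈ E' → G.adj (f i u) v := by
    intro i v
    by_cases hi : i ∈ I
    · by_cases hv : v ∈ E'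
      · have hi' := Finset.mem_sdiff.1 hi
        have his : i < s := Finset.mem_range.1 hi'.1
        have hng : i ∉ good s f v := fun hg => hi'.2 (Finset.mem_biUnion.2 ⟨v, hv, hg⟩)
        rw [mem_good] at hng
        push Not at hng
        obtain ⟨u, hu⟩ := hng his
        refine ⟨u, fun _ _ => ?_⟩
        have hne : v ≠ f i u := by
          rintro rfl
          obtain ⟨w⟩ := (inferInstance : Nonempty H.V)
          exact G.asymm _ _ (hE'j _ hv w) (hff j hj w _ (mem_blobSet his u))
        rcases G.total _ _ hne with h | h
        · exact absurd h hu
        · exact h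
      · exact ⟨Classical.arbitrary _, fun _ h => absurd h hv⟩
    · exact ⟨Classical.arbitrary _, fun h => absurd h hi⟩
  choose φ hφ using hbad
  have pig1 := Finset.exists_le_card_fiber_of_mul_le_card_of_maps_to
    (s := I) (t := (Finset.univ : Finset ({x // x ∈ E'} → H.V)))
    (f := fun i => fun v => φ i v.1) (n := r) (fun _ _ => Finset.mem_univ _)
    Finset.univ_nonempty (by
      rw [Finset.card_univ, Fintype.card_fun, Fintype.card_coe, hE'card]
      calc _ = r * Fintype.card H.V ^ m := by ring
        _ ≤ m * t := hmt
        _ ≤ _ := hIcard)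
  obtain ⟨ψ, -, hψ⟩ := pig1
  have pig2 := Finset.exists_le_card_fiber_of_mul_le_card_of_maps_to
    (s := (Finset.univ : Finset {x // x ∈ E'})) (t := (Finset.univ : Finset H.V))
    (f := ψ) (n := r) (fun _ _ => Finset.mem_univ _)
    Finset.univ_nonempty (by
      rw [Finset.card_univ, Finset.card_univ, Fintype.card_coe, hE'card, hm, mul_comm])
  obtain ⟨w, -, hw⟩ := pig2
  refine hG (contains_delta hK (f' j) (hf' j hj).1
    ((I.filter (fun i => (fun v : {x // x ∈ E'} => φ i v.1) = ψ)).image (fun i => f i w))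
    ((Finset.univ.filter (fun v => ψ v = w)).image Subtype.val) ?_ ?_ ?_ ?_ ?_)
  · rw [← hr, Finset.card_image_of_injOn]
    · exact hψ
    · intro a ha b hb hab
      have ha' : a < s := Finset.mem_range.1 (Finset.mem_sdiff.1 (Finset.mem_filter.1 ha).1).1
      have hb' : b < s := Finset.mem_range.1 (Finset.mem_sdiff.1 (Finset.mem_filter.1 hb).1).1
      simp only at hab
      rcases lt_trichotomy a b with h | h | h
      · have := (hf b hb').2 a h w w
        rw [hab] at this
        exact absurd this (G.irrefl' _)
      · exact h
      · have := (hf a ha').2 b h w w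
        rw [hab] at this
        exact absurd this (G.irrefl' _)
  · rw [← hr, Finset.card_image_of_injective _ Subtype.val_injective]
    exact hw
  · intro u b hb
    obtain ⟨i, hi, rfl⟩ := Finset.mem_image.1 hb
    have hi' : i < s := Finset.mem_range.1 (Finset.mem_sdiff.1 (Finset.mem_filter.1 hi).1).1
    exact hff j hj u _ (mem_blobSet hi' w)
  · intro b hb c hc
    obtain ⟨i, hi, rfl⟩ := Finset.mem_image.1 hb
    obtain ⟨v, hv, rfl⟩ := Finset.mem_image.1 hc
    have hi1 := Finset.mem_filter.1 hi
    have hv1 := (Finset.mem_filter.1 hv).2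
    have := hφ i v.1 hi1.1 v.2
    have e : φ i v.1 = w := by rw [← hv1, ← hi1.2]
    rwa [e] at this
  · intro c hc u
    obtain ⟨v, hv, rfl⟩ := Finset.mem_image.1 hc
    exact hE'j v.1 v.2 u

theorem delta_rebel_of_nonempty (H K : Tournament) [Nonempty H.V]
    (hH : H.IsRebel) (hK : K.IsTransitiveSet Set.univ) : (delta H K K).IsRebel := by
  classical
  obtain ⟨c, hcpos, hc⟩ := hH
  obtain ⟨r, hr⟩ : ∃ r, r = 2 ^ (Fintype.card K.V) := ⟨_, rfl⟩
  obtain ⟨m, hm⟩ : ∃ m, m = r * Fintype.card H.V := ⟨_, rfl⟩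
  obtain ⟨t, htd⟩ : ∃ t, t = 2 * m * m + 1 + r * Fintype.card H.V ^ m := ⟨_, rfl⟩
  obtain ⟨s, hs⟩ : ∃ s, s = 2 * m * t := ⟨_, rfl⟩
  have hHpos : 0 < Fintype.card H.V := Fintype.card_pos
  have hrpos : 0 < r := by rw [hr]; positivity
  have hmpos : 0 < m := by rw [hm]; positivity
  have hts : t ≤ s := by rw [hs]; nlinarith
  refine ⟨c + s * Fintype.card H.V + s * Fintype.card H.V, by omega, ?_⟩
  intro G hG
  by_contra hdom
  push Not at hdom
  obtain ⟨f0, hf0, -⟩ := exists_blob hc G ∅ s (by simp only [Finset.card_empty]; omega)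
  have hex : ∃ n, ∃ f, G.IsBlob H s f ∧ (upper s t f).card = n := ⟨_, f0, hf0, rfl⟩
  obtain ⟨f, hf, hfn⟩ := Nat.find_spec hex
  have hmin := fun g (hg : G.IsBlob H s g) => Nat.find_min' hex ⟨g, hg, rfl⟩
  rw [← hfn] at hmin
  obtain ⟨f', hf', hff⟩ := exists_blob hc G (blobSet s f) s (by
    have := card_blobSet s f
    omega)
  have hle := hmin f' hf'
  have hexc := exceptional hK hG r m t s hr hm hs (by
    calc r * Fintype.card H.V ^ m ≤ t := by omega
      _ ≤ m * t := Nat.le_mul_of_pos_left _ hmpos) (by omega) f f' hf hf' hff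
    (upper s t f' \ upper s t f) (fun v hv => Finset.mem_sdiff.1 hv)
  obtain ⟨w⟩ := (inferInstance : Nonempty H.V)
  let L : Finset G.V := (Finset.range t).image (fun i => f' i w)
  have hLcard : L.card = t := by
    have : L.card = (Finset.range t).card := by
      refine Finset.card_image_of_injOn ?_
      intro a ha b hb hab
      have ha' : a < s := lt_of_lt_of_le (by simpa using ha) hts
      have hb' : b < s := lt_of_lt_of_le (by simpa using hb) hts
      simp only at hab
      rcases lt_trichotomy a b with h | h | h
      · have := (hf' b hb').2 a h w w
        rw [hab] at this
        exact absurd this (G.irrefl' _)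
      · exact h
      · have := (hf' a ha').2 b h w w
        rw [hab] at this
        exact absurd this (G.irrefl' _)
    simpa using this
  have hLsub : L ⊆ upper s t f := by
    intro v hv
    obtain ⟨i, hi, rfl⟩ := Finset.mem_image.1 hv
    have hi' : i < s := lt_of_lt_of_le (Finset.mem_range.1 hi) hts
    rw [mem_upper]
    have : Finset.range s ⊆ good s f (f' i w) := by
      intro j hj
      have hj := Finset.mem_range.1 hj
      exact mem_good.2 ⟨hj, fun u => hff i hi' w _ (mem_blobSet hj u)⟩
    have := Finset.card_le_card this
    rw [Finset.card_range] at this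
    omega
  have hLnot : ∀ v ∈ L, v ∉ upper s t f' := by
    intro v hv hvu
    obtain ⟨i, hi, rfl⟩ := Finset.mem_image.1 hv
    have hi := Finset.mem_range.1 hi
    rw [mem_upper] at hvu
    have : good s f' (f' i w) ⊆ Finset.range i := by
      intro j hj
      obtain ⟨hjs, hj⟩ := mem_good.1 hj
      rw [Finset.mem_range]
      by_contra hij
      rcases Nat.lt_or_ge i j with h | h
      · exact G.asymm _ _ (hj w) ((hf' j hjs).2 i h w w)
      · have : j = i := by omega
        subst this
        exact G.irrefl' _ (hj w)
    have := Finset.card_le_card this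
    rw [Finset.card_range] at this
    omega
  have hsub : upper s t f' ⊆ (upper s t f \ L) ∪ (upper s t f' \ upper s t f) := by
    intro v hv
    by_cases h : v ∈ upper s t f
    · exact Finset.mem_union_left _ (Finset.mem_sdiff.2 ⟨h, fun hL => hLnot v hL hv⟩)
    · exact Finset.mem_union_right _ (Finset.mem_sdiff.2 ⟨hv, h⟩)
  have c1 := Finset.card_le_card hsub
  have c2 := Finset.card_union_le (upper s t f \ L) (upper s t f' \ upper s t f)
  have c3 := Finset.card_sdiff_add_card_eq_card hLsub
  omega

theorem oneT_rebel : oneT.IsRebel := by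
  refine ⟨1, one_pos, fun G hG => ?_⟩
  have hem : ∀ v : G.V, False := fun v =>
    hG (contains_of_map (H := oneT) (fun _ => v) (fun _ _ h => False.elim h))
  have := G.dom_le ∅ (fun v _ => (hem v).elim)
  rw [Finset.card_empty] at this
  omega

end Tournament

/-- If `H` is a rebel and `K` is a transitive tournament, then `Δ(H,K,K)` is a rebel. -/
theorem delta_rebel_transitive (H K : Tournament)
    (hH : H.IsRebel) (hK : K.IsTransitiveSet Set.univ) :
    (Tournament.delta H K K).IsRebel := by
  by_cases hne : Nonempty H.V
  · exact Tournament.delta_rebel_of_nonempty H K hH hK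
  · have : Nonempty Tournament.oneT.V := ⟨PUnit.unit⟩
    obtain ⟨c, hc, h⟩ := Tournament.delta_rebel_of_nonempty Tournament.oneT K
      Tournament.oneT_rebel hK
    refine ⟨c, hc, fun G hG => h G (fun hcon => hG ?_)⟩
    obtain ⟨f, -, -, hf⟩ := hcon
    refine Tournament.contains_of_map (H := Tournament.delta H K K)
      (fun x : H.V ⊕ K.V ⊕ K.V => f (Sum.map (fun _ => PUnit.unit) id x)) ?_
    rintro (x | x | x) (y | y | y) hxy
    all_goals first
      | exact (hne ⟨x⟩).elim
      | exact (hne ⟨y⟩).elim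
      | exact (hf _ _).1 hxy
end
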